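/- Let G=(V,E) be a Hamiltonian cubic graph on n vertices that is isomorphic neither to H1 nor to H2. Then there exists S ⊊ V with |S| = ⌊(2n+1)/3⌋ such that G[S] is a proportionally dense subgraph and the induced subgraph G[S] is connected. -/

import Mathlib

open SimpleGraph

/-- Number of neighbors of `v` inside `T`. -/
noncomputable def degIn {W : Type*} (G : SimpleGraph W) (T : Set W) (v : W) : ℕ :=
  (T ∩ G.neighborSet v).ncard

/-- `G[S]` is a proportionally dense subgraph. -/
def IsPDS {W : Type*} (G : SimpleGraph W) (S : Set W) : Prop :=
  S ⊂ Set.univ ∧ 2 ≤ S.ncard ∧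
    ∀ u ∈ S, degIn G Sᶜ u * (S.ncard - 1) ≤ degIn G S u * Sᶜ.ncard

/-- The exceptional cubic graph `H1` on `ZMod 8`: the 8-cycle together with the
chords `{0,2}, {1,3}, {4,6}, {5,7}`. -/
def H1 : SimpleGraph (ZMod 8) :=
  SimpleGraph.fromRel (fun i j =>
    j = i + 1 ∨ (i = 0 ∧ j = 2) ∨ (i = 1 ∧ j = 3) ∨ (i = 4 ∧ j = 6) ∨ (i = 5 ∧ j = 7))

/-- The exceptional cubic graph `H2` on `ZMod 8`: the 8-cycle together with the
chords `{0,3}, {1,6}, {2,5}, {4,7}`. -/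
def H2 : SimpleGraph (ZMod 8) :=
  SimpleGraph.fromRel (fun i j =>
    j = i + 1 ∨ (i = 0 ∧ j = 3) ∨ (i = 1 ∧ j = 6) ∨ (i = 2 ∧ j = 5) ∨ (i = 4 ∧ j = 7))

/-- `G` has a connected proportionally dense subgraph on `⌊(2n+1)/3⌋` vertices. -/
def HasConnectedPDS {V : Type*} [Fintype V] (G : SimpleGraph V) : Prop :=
  ∃ S : Set V, IsPDS G S ∧ S.ncard = (2 * Fintype.card V + 1) / 3 ∧ (G.induce S).Connected

/-- A labelling of the vertices of a cubic graph on `n` vertices along a Hamiltonian cycle by the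
integers modulo `n`: the vertex `p i` is adjacent to `p (i - 1)`, `p (i + 1)` and, through its
chord, to `p (i + d i)`. -/
structure CycleLabelling {V : Type*} [Fintype V] (G : SimpleGraph V) (n : ℤ) (p : ℤ → V)
    (d : ℤ → ℤ) : Prop where
  card_eq : (Fintype.card V : ℤ) = n
  ncard_neighborSet : ∀ v, (G.neighborSet v).ncard = 3
  eq_iff : ∀ i j, p i = p j ↔ n ∣ i - j
  surjective : Function.Surjective p
  adj_iff : ∀ i x, G.Adj (p i) x ↔ x = p (i - 1) ∨ x = p (i + 1) ∨ x = p (i + d i)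
  two_le : ∀ i, 2 ≤ d i
  le_sub_two : ∀ i, d i ≤ n - 2

/-- A multiple of `n` strictly between `-n` and `n` vanishes. -/
lemma eq_zero_of_dvd_of_lt {n x : ℤ} (h : n ∣ x) (h₁ : -n < x) (h₂ : x < n) : x = 0 :=
  Int.eq_zero_of_abs_lt_dvd h (abs_lt.mpr ⟨h₁, h₂⟩)

namespace CycleLabelling

variable {V : Type*} [Fintype V] {G : SimpleGraph V} {n : ℤ} {p : ℤ → V} {d : ℤ → ℤ}

lemma four_le (L : CycleLabelling G n p d) : 4 ≤ n := by
  have h₁ := L.two_le 0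
  have h₂ := L.le_sub_two 0
  omega

lemma eq_of_dvd (L : CycleLabelling G n p d) {i x y : ℤ} (hx : 2 ≤ x) (hx' : x ≤ n - 2)
    (hy : 2 ≤ y) (hy' : y ≤ n - 2) (h : p (i + x) = p (i + y)) : x = y := by
  rw [L.eq_iff] at h
  have := eq_zero_of_dvd_of_lt h (by omega) (by omega)
  omega

lemma eq_d_of_adj (L : CycleLabelling G n p d) {i x : ℤ} (hx : 2 ≤ x) (hx' : x ≤ n - 2)
    (h : G.Adj (p i) (p (i + x))) : x = d i := by
  rcases (L.adj_iff _ _).mp h with h | h | h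
  · rw [L.eq_iff] at h
    have := eq_zero_of_dvd_of_lt (x := x + 1) (by convert h using 1; ring) (by omega) (by omega)
    omega
  · rw [L.eq_iff] at h
    have := eq_zero_of_dvd_of_lt h (by omega) (by omega)
    omega
  · exact L.eq_of_dvd hx hx' (L.two_le i) (L.le_sub_two i) h

lemma d_eq_of_dvd (L : CycleLabelling G n p d) {i j : ℤ} (h : n ∣ i - j) : d i = d j := by
  refine L.eq_d_of_adj (L.two_le i) (L.le_sub_two i) ?_
  have h₁ : p j = p i := ((L.eq_iff i j).mpr h).symm
  have h₂ : p (j + d i) = p (i + d i) := (L.eq_iff _ _).mpr ((dvd_sub_comm.mp h).trans ⟨1, by ring⟩)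
  rw [h₁, h₂, L.adj_iff]
  simp

lemma d_add_mul (L : CycleLabelling G n p d) (i k : ℤ) : d (i + n * k) = d i :=
  L.d_eq_of_dvd ⟨k, by ring⟩

lemma d_add_d (L : CycleLabelling G n p d) (i : ℤ) : d (i + d i) = n - d i := by
  have h₁ := L.two_le i
  have h₂ := L.le_sub_two i
  refine (L.eq_d_of_adj (by omega) (by omega) ?_).symm
  have h : p (i + d i + (n - d i)) = p i := (L.eq_iff _ _).mpr ⟨1, by ring⟩
  rw [h, G.adj_comm, L.adj_iff]
  simp

/-- If the chord at `i` leads forward to `j`, it leads backward from `j`. -/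
lemma d_of_forward (L : CycleLabelling G n p d) {i j : ℤ} (h : d i = j - i) :
    d j = n - (j - i) := by
  have := L.d_add_d i
  rwa [h, add_sub_cancel] at this

/-- If the chord at `i` leads backward to `j`, it leads forward from `j`. -/
lemma d_of_backward (L : CycleLabelling G n p d) {i j : ℤ} (h : d i = n - (i - j)) :
    d j = i - j := by
  have := L.d_of_forward (i := i) (j := j + n) (by omega)
  rw [← L.d_add_mul j 1, mul_one]
  omega

/-- Rotating the labelling. -/
lemma rotate (L : CycleLabelling G n p d) (r : ℤ) :
    CycleLabelling G n (fun i => p (i + r)) (fun i => d (i + r)) where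
  card_eq := L.card_eq
  ncard_neighborSet := L.ncard_neighborSet
  eq_iff i j := by rw [L.eq_iff]; ring_nf
  surjective v := by
    obtain ⟨i, rfl⟩ := L.surjective v
    exact ⟨i - r, by simp⟩
  adj_iff i x := by
    rw [L.adj_iff, show i - 1 + r = i + r - 1 by ring, show i + 1 + r = i + r + 1 by ring,
      show i + d (i + r) + r = i + r + d (i + r) by ring]
  two_le i := L.two_le _
  le_sub_two i := L.le_sub_two _

lemma adj_pred (L : CycleLabelling G n p d) (i : ℤ) : G.Adj (p i) (p (i - 1)) :=
  (L.adj_iff _ _).mpr (Or.inl rfl)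

lemma adj_succ (L : CycleLabelling G n p d) (i : ℤ) : G.Adj (p i) (p (i + 1)) :=
  (L.adj_iff _ _).mpr (Or.inr (Or.inl rfl))

lemma adj_chord (L : CycleLabelling G n p d) (i : ℤ) : G.Adj (p i) (p (i + d i)) :=
  (L.adj_iff _ _).mpr (Or.inr (Or.inr rfl))

lemma sub_n (L : CycleLabelling G n p d) (i : ℤ) : p (i - n) = p i :=
  (L.eq_iff _ _).mpr ⟨-1, by ring⟩

lemma pred_ne_succ (L : CycleLabelling G n p d) (i : ℤ) : p (i - 1) ≠ p (i + 1) := by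
  intro h
  have := eq_zero_of_dvd_of_lt ((L.eq_iff _ _).mp h) (by have := L.four_le; omega)
    (by have := L.four_le; omega)
  omega

lemma pred_ne_chord (L : CycleLabelling G n p d) (i : ℤ) : p (i - 1) ≠ p (i + d i) := by
  intro h
  have h₁ := L.two_le i
  have h₂ := L.le_sub_two i
  have := eq_zero_of_dvd_of_lt ((L.eq_iff _ _).mp h) (by omega) (by omega)
  omega

lemma succ_ne_chord (L : CycleLabelling G n p d) (i : ℤ) : p (i + 1) ≠ p (i + d i) := by
  intro h
  have h₁ := L.two_le i
  have h₂ := L.le_sub_two i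
  have := eq_zero_of_dvd_of_lt ((L.eq_iff _ _).mp h) (by omega) (by omega)
  omega

/-- A set of at least two vertices of the right size in which every vertex keeps two of its
neighbours is proportionally dense. -/
lemma isPDS_of_two_le_degIn (L : CycleLabelling G n p d) {S : Set V}
    (hS : S.ncard = (2 * Fintype.card V + 1) / 3) (hdeg : ∀ u ∈ S, 2 ≤ degIn G S u) :
    IsPDS G S := by
  have hn := L.four_le
  have hc := L.card_eq
  have hcompl : S.ncard + Sᶜ.ncard = Fintype.card V := by
    rw [Set.ncard_add_ncard_compl, Nat.card_eq_fintype_card]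
  refine ⟨Set.ssubset_univ_iff.mpr ?_, by omega, fun u hu => ?_⟩
  · rintro rfl
    rw [Set.ncard_univ, Nat.card_eq_fintype_card] at hS
    omega
  · have h₁ := hdeg u hu
    have h₂ : degIn G S u + degIn G Sᶜ u = 3 := by
      rw [← L.ncard_neighborSet u, degIn, degIn, ← Set.ncard_union_eq,
        ← Set.union_inter_distrib_right, Set.union_compl_self, Set.univ_inter]
      · exact (disjoint_compl_right).mono Set.inter_subset_left Set.inter_subset_left
    calc degIn G Sᶜ u * (S.ncard - 1) ≤ 1 * (S.ncard - 1) := Nat.mul_le_mul_right _ (by omega)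
      _ ≤ 2 * Sᶜ.ncard := by omega
      _ ≤ _ := Nat.mul_le_mul_right _ h₁

/-- A set `Q` of labels in a window of length `n` starting at `a ∈ Q` yields a connected
proportionally dense subgraph as soon as each label of `Q` keeps two of its three neighbours and
each label other than `a` has a smaller neighbour in `Q`. -/
lemma hasConnectedPDS (L : CycleLabelling G n p d) (Q : Finset ℤ) (a : ℤ) (ha : a ∈ Q)
    (hcard : (Q.card : ℤ) = (2 * n + 1) / 3) (hwin : ∀ i ∈ Q, a ≤ i ∧ i < a + n)
    (hdeg : ∀ i ∈ Q, (i - 1 ∈ Q ∧ i + 1 ∈ Q) ∨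
      ((i - 1 ∈ Q ∨ i + 1 ∈ Q) ∧ (i + d i ∈ Q ∨ i + d i - n ∈ Q)))
    (hlow : ∀ i ∈ Q, i = a ∨ i - 1 ∈ Q ∨ i + d i - n ∈ Q) :
    HasConnectedPDS G := by
  have hS : (p '' (Q : Set ℤ)).ncard = (2 * Fintype.card V + 1) / 3 := by
    rw [Set.InjOn.ncard_image, Set.ncard_coe_finset]
    · have := L.card_eq
      omega
    · intro i hi j hj hij
      have h₁ := hwin i hi
      have h₂ := hwin j hj
      have := eq_zero_of_dvd_of_lt ((L.eq_iff _ _).mp hij) (by omega) (by omega)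
      omega
  have hmem : ∀ i ∈ Q, p i ∈ p '' (Q : Set ℤ) := fun i hi => ⟨i, hi, rfl⟩
  refine ⟨p '' (Q : Set ℤ), L.isPDS_of_two_le_degIn hS ?_, hS, ?_⟩
  · rintro _ ⟨i, hi, rfl⟩
    have key : ∀ x y, x ≠ y → x ∈ p '' (Q : Set ℤ) → y ∈ p '' (Q : Set ℤ) → G.Adj (p i) x →
        G.Adj (p i) y → 2 ≤ degIn G (p '' (Q : Set ℤ)) (p i) := by
      intro x y hxy hx hy hix hiy
      rw [← Set.ncard_pair hxy]
      refine Set.ncard_le_ncard ?_ (Set.toFinite _)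
      rintro z (rfl | rfl)
      exacts [⟨hx, hix⟩, ⟨hy, hiy⟩]
    rcases hdeg i hi with ⟨h₁, h₂⟩ | ⟨h, hch⟩
    · exact key _ _ (L.pred_ne_succ i) (hmem _ h₁) (hmem _ h₂) (L.adj_pred i) (L.adj_succ i)
    · have hch' : p (i + d i) ∈ p '' (Q : Set ℤ) := by
        rcases hch with h | h
        · exact hmem _ h
        · exact L.sub_n (i + d i) ▸ hmem _ h
      rcases h with h | h
      · exact key _ _ (L.pred_ne_chord i) (hmem _ h) hch' (L.adj_pred i) (L.adj_chord i)
      · exact key _ _ (L.succ_ne_chord i) (hmem _ h) hch' (L.adj_succ i) (L.adj_chord i)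
  · have hreach : ∀ m : ℕ, ∀ i (hi : i ∈ Q), i - a ≤ m →
        (G.induce (p '' (Q : Set ℤ))).Reachable ⟨p i, hmem i hi⟩ ⟨p a, hmem a ha⟩ := by
      intro m
      induction m with
      | zero =>
        intro i hi him
        obtain rfl : i = a := by have := hwin i hi; omega
        exact .refl _
      | succ m ih =>
        intro i hi him
        rcases hlow i hi with rfl | h | h
        · exact .refl _
        · exact Reachable.trans (Adj.reachable (by simpa using L.adj_pred i))
            (ih (i - 1) h (by push_cast at him; omega))
        · refine Reachable.trans (Adj.reachable (v := ⟨p (i + d i - n), hmem _ h⟩) ?_)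
            (ih _ h ?_)
          · simpa [L.sub_n] using L.adj_chord i
          · have := L.le_sub_two i
            push_cast at him
            omega
    rw [connected_iff_exists_forall_reachable]
    refine ⟨⟨p a, hmem a ha⟩, ?_⟩
    rintro ⟨_, i, hi, rfl⟩
    exact (hreach (i - a).toNat i hi (by omega)).symm

end CycleLabelling

/-- Every Hamiltonian cubic graph has a labelling along a Hamiltonian cycle. -/
lemma exists_cycleLabelling {V : Type*} [Fintype V] [DecidableEq V] (G : SimpleGraph V)
    (hcubic : ∀ v : V, (G.neighborSet v).ncard = 3) (hham : G.IsHamiltonian) :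
    ∃ (n : ℤ) (p : ℤ → V) (d : ℤ → ℤ), CycleLabelling G n p d := by
  have hcard : Fintype.card V ≠ 1 := by
    intro h
    obtain ⟨v, hv⟩ := Fintype.card_eq_one_iff.mp h
    have h₁ := hcubic v
    have h₂ : (G.neighborSet v).ncard ≤ ({v} : Set V).ncard :=
      Set.ncard_le_ncard (fun x _ => hv x) (Set.toFinite _)
    rw [Set.ncard_singleton] at h₂
    omega
  obtain ⟨a, w, hw⟩ := hham hcard
  have hlen := hw.length_eq
  have h3 := hw.isCycle.three_le_length
  obtain ⟨n, hn⟩ : ∃ n : ℤ, n = Fintype.card V := ⟨_, rfl⟩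
  have hnpos : 0 < n := by omega
  set p : ℤ → V := fun i => w.getVert (i % n).toNat with hp
  have heq : ∀ i j, p i = p j ↔ n ∣ i - j := by
    intro i j
    have hi := Int.emod_nonneg i hnpos.ne'
    have hj := Int.emod_nonneg j hnpos.ne'
    have hi' := Int.emod_lt_of_pos i hnpos
    have hj' := Int.emod_lt_of_pos j hnpos
    have h₁ : n ∣ i - j ↔ i % n = j % n := by
      rw [Int.emod_eq_emod_iff_emod_sub_eq_zero, Int.dvd_iff_emod_eq_zero]
    rw [h₁]
    refine ⟨fun h => ?_, fun h => by simp only [hp, h]⟩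
    have := hw.isCycle.getVert_injOn' (x₁ := (i % n).toNat) (x₂ := (j % n).toNat)
      (by simp; omega) (by simp; omega) h
    omega
  have hsucc : ∀ i, G.Adj (p i) (p (i + 1)) := by
    intro i
    have hi := Int.emod_nonneg i hnpos.ne'
    have hi' := Int.emod_lt_of_pos i hnpos
    have h₁ : p (i + 1) = w.getVert ((i % n).toNat + 1) := by
      have h₂ : p (i + 1) = p (i % n + 1) := by
        rw [heq]
        exact ⟨i / n, by have := Int.emod_add_mul_ediv i n; linarith⟩
      rw [h₂]
      rcases (show i % n + 1 < n ∨ i % n + 1 = n by omega) with h | h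
      · simp only [hp]
        rw [Int.emod_eq_of_lt (by omega) h]
        congr 1
        omega
      · simp only [hp, h, Int.emod_self, Int.toNat_zero, Walk.getVert_zero]
        rw [show (i % n).toNat + 1 = w.length by omega, Walk.getVert_length]
    rw [h₁]
    exact w.adj_getVert_succ (by omega)
  have hpred : ∀ i, G.Adj (p i) (p (i - 1)) := by
    intro i
    simpa using (hsucc (i - 1)).symm
  have hsurj : Function.Surjective p := by
    intro v
    obtain ⟨m, rfl, hm⟩ := Walk.mem_support_iff_exists_getVert.mp (hw.mem_support v)
    rcases (show (m : ℤ) < n ∨ m = w.length by omega) with h | h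
    · refine ⟨m, ?_⟩
      simp only [hp]
      rw [Int.emod_eq_of_lt (by omega) h, Int.toNat_natCast]
    · exact ⟨0, by simp [hp, h]⟩
  have hd : ∀ i, ∃ x : ℤ, 2 ≤ x ∧ x ≤ n - 2 ∧
      ∀ v, G.Adj (p i) v ↔ v = p (i - 1) ∨ v = p (i + 1) ∨ v = p (i + x) := by
    intro i
    obtain ⟨u, hu, hu₁, hu₂⟩ : ∃ u, G.Adj (p i) u ∧ u ≠ p (i - 1) ∧ u ≠ p (i + 1) := by
      by_contra! hcon
      have h₁ : (G.neighborSet (p i)).ncard ≤ ({p (i - 1), p (i + 1)} : Set V).ncard := by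
        refine Set.ncard_le_ncard (fun x hx => ?_) (Set.toFinite _)
        by_cases h : x = p (i - 1)
        · exact Or.inl h
        · exact Or.inr (hcon x hx h)
      have h₂ := Set.ncard_insert_le (p (i - 1)) {p (i + 1)}
      rw [Set.ncard_singleton] at h₂
      rw [hcubic] at h₁
      omega
    obtain ⟨j, rfl⟩ := hsurj u
    have hx := Int.emod_nonneg (j - i) hnpos.ne'
    have hx' := Int.emod_lt_of_pos (j - i) hnpos
    have hj : p j = p (i + (j - i) % n) := by
      rw [heq]
      exact ⟨(j - i) / n, by have := Int.emod_add_mul_ediv (j - i) n; linarith⟩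
    have h0 : (j - i) % n ≠ 0 := by
      intro h
      rw [hj, h, add_zero] at hu
      exact G.loopless.irrefl _ hu
    have h1 : (j - i) % n ≠ 1 := fun h => hu₂ (by rw [hj, h])
    have h2 : (j - i) % n ≠ n - 1 := by
      intro h
      refine hu₁ ?_
      rw [hj, h, heq]
      exact ⟨1, by ring⟩
    refine ⟨(j - i) % n, by omega, by omega, fun v => ?_⟩
    rw [← hj]
    have hsub : ({p (i - 1), p (i + 1), p j} : Set V) = G.neighborSet (p i) := by
      refine Set.eq_of_subset_of_ncard_le ?_ ?_ (Set.toFinite _)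
      · rintro x (rfl | rfl | rfl)
        exacts [hpred i, hsucc i, hu]
      · rw [hcubic, Set.ncard_eq_three.mpr ⟨_, _, _, ?_, hu₁.symm, hu₂.symm, rfl⟩]
        intro h
        have := eq_zero_of_dvd_of_lt ((heq _ _).mp h) (by omega) (by omega)
        omega
    rw [← mem_neighborSet, ← hsub]
    simp
  choose d h2d hd2 hadj using hd
  exact ⟨n, p, d, hn.symm, hcubic, heq, hsurj, hadj, h2d, hd2⟩

namespace CycleLabelling

variable {V : Type*} [Fintype V] {G : SimpleGraph V} {n : ℤ} {p : ℤ → V} {d : ℤ → ℤ}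

/-- An interval of the Hamiltonian cycle whose ends have their chords inside. -/
lemma hasConnectedPDS_interval (L : CycleLabelling G n p d) {s a : ℤ} (hs : s = (2 * n + 1) / 3)
    (ha : d a ≤ s - 1) (hb : n - d (a + s - 1) ≤ s - 1) : HasConnectedPDS G := by
  have hn := L.four_le
  have ha₂ := L.two_le a
  have hb₂ := L.le_sub_two (a + s - 1)
  refine L.hasConnectedPDS (Finset.Icc a (a + s - 1)) a ?_ ?_ ?_ ?_ ?_
  · rw [Finset.mem_Icc]; omega
  · rw [Int.card_Icc]; omega
  · intro i hi; rw [Finset.mem_Icc] at hi; omega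
  · intro i hi
    simp only [Finset.mem_Icc] at hi ⊢
    rcases (show i = a ∨ i = a + s - 1 ∨ (a < i ∧ i < a + s - 1) by omega) with rfl | rfl | h <;>
      omega
  · intro i hi
    simp only [Finset.mem_Icc] at hi ⊢
    omega

/-- An interval of the Hamiltonian cycle with an inner interval removed, where the four ends have
their chords inside. -/
lemma hasConnectedPDS_split (L : CycleLabelling G n p d) {a u w b : ℤ}
    (hau : a < u) (huw : u + 2 ≤ w) (hwb : w < b) (hba : b < a + n)
    (hcard : (u - a + 1) + (b - w + 1) = (2 * n + 1) / 3)
    (ha : a + d a ≤ u ∨ (w ≤ a + d a ∧ a + d a ≤ b))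
    (hu : a ≤ u + d u - n ∨ (w ≤ u + d u ∧ u + d u ≤ b))
    (hw : a ≤ w + d w - n ∧ w + d w - n ≤ u)
    (hb : w ≤ b + d b - n ∨ (a ≤ b + d b - n ∧ b + d b - n ≤ u)) : HasConnectedPDS G := by
  have ha₂ := L.two_le a
  have hu₂ := L.le_sub_two u
  have hb₂ := L.le_sub_two b
  refine L.hasConnectedPDS (Finset.Icc a u ∪ Finset.Icc w b) a ?_ ?_ ?_ ?_ ?_
  · rw [Finset.mem_union, Finset.mem_Icc]; omega
  · rw [Finset.card_union_of_disjoint, Int.card_Icc, Int.card_Icc]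
    · omega
    · rw [Finset.disjoint_left]
      intro i hi
      rw [Finset.mem_Icc] at hi ⊢
      omega
  · intro i hi; rw [Finset.mem_union, Finset.mem_Icc, Finset.mem_Icc] at hi; omega
  · intro i hi
    simp only [Finset.mem_union, Finset.mem_Icc] at hi ⊢
    rcases (show i = a ∨ i = u ∨ i = w ∨ i = b ∨ (a < i ∧ i < u) ∨ (w < i ∧ i < b) by omega)
      with rfl | rfl | rfl | rfl | h | h <;> omega
  · intro i hi
    simp only [Finset.mem_union, Finset.mem_Icc] at hi ⊢
    rcases (show i = w ∨ i ≠ w by omega) with rfl | h <;> omega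

/-- If no interval works, every chord has a short side of length at most `t`, and the set of labels
whose short side leads forward is invariant under translation by `t + 1`. -/
lemma short_of_not_hasConnectedPDS (L : CycleLabelling G n p d) (hG : ¬ HasConnectedPDS G)
    {s t : ℤ} (hs : s = (2 * n + 1) / 3) (ht : t = n - s) :
    (∀ i, d i ≤ t ∨ s ≤ d i) ∧ ∀ i, d i ≤ t ↔ d (i - (t + 1)) ≤ t := by
  have hn := L.four_le
  have hstep : ∀ i, d i ≤ s - 1 → d (i - (t + 1)) ≤ t := by
    intro i hi
    by_contra hcon
    refine hG (L.hasConnectedPDS_interval (a := i) hs hi ?_)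
    have h := L.d_add_mul (i - (t + 1)) 1
    rw [show i - (t + 1) + n * 1 = i + s - 1 by rw [ht]; ring] at h
    omega
  have hiter : ∀ (m : ℕ) i, d i ≤ t → d (i - m * (t + 1)) ≤ t := by
    intro m
    induction m with
    | zero => intro i hi; simpa using hi
    | succ m ih =>
      intro i hi
      have h := hstep _ (show d (i - m * (t + 1)) ≤ s - 1 by have := ih i hi; omega)
      rwa [show i - m * (t + 1) - (t + 1) = i - (m + 1 : ℕ) * (t + 1) by push_cast; ring] at h
  have hback : ∀ i, d (i - (t + 1)) ≤ t → d i ≤ t := by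
    intro i hi
    have h := hiter (n - 1).toNat _ hi
    rw [Int.toNat_of_nonneg (by omega)] at h
    rwa [← L.d_add_mul i (-(t + 1)),
      show i + n * -(t + 1) = i - (t + 1) - (n - 1) * (t + 1) by ring]
  refine ⟨fun i => ?_, fun i => ⟨fun h => hstep i (by omega), hback i⟩⟩
  by_contra! hcon
  have := hback i (hstep i (by omega))
  omega

/-- The forward short sides and the backward short sides are equally many. -/
lemma sum_sign_eq_zero (L : CycleLabelling G n p d) {s t : ℤ} (hst : t < s) (ht : t = n - s)
    (hd : ∀ i, d i ≤ t ∨ s ≤ d i) :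
    ∑ i ∈ Finset.range n.toNat, (if d i ≤ t then (1 : ℤ) else -1) = 0 := by
  have hn := L.four_le
  have hmod : ∀ i : ℕ, ∃ j : ℕ, j < n.toNat ∧ n ∣ (j : ℤ) - (i + d i) := by
    intro i
    have h₁ := Int.emod_nonneg (i + d i) (show n ≠ 0 by omega)
    have h₂ := Int.emod_lt_of_pos (i + d i) (show 0 < n by omega)
    refine ⟨((i + d i) % n).toNat, by omega, ?_⟩
    rw [Int.toNat_of_nonneg h₁]
    exact ⟨-((i + d i) / n), by have := Int.emod_add_mul_ediv (i + d i) n; linarith⟩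
  choose g hlt hdvd using hmod
  have hdg : ∀ i : ℕ, d (g i) = n - d i := fun i => by
    rw [L.d_eq_of_dvd (hdvd i), L.d_add_d]
  refine Finset.sum_involution (fun i _ => g i) ?_ ?_ ?_ ?_
  · intro i _
    have h := hd i
    have hg := hdg i
    split_ifs <;> omega
  · intro i _ _ hgi
    have h := hd i
    have hg := hdg i
    rw [hgi] at hg
    omega
  · intro i _
    exact Finset.mem_range.mpr (hlt i)
  · intro i hi
    rw [Finset.mem_range] at hi
    have h₁ : n ∣ (g (g i) : ℤ) - i := by
      obtain ⟨x, hx⟩ := hdvd i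
      obtain ⟨y, hy⟩ := hdvd (g i)
      rw [hdg i] at hy
      exact ⟨x + y + 1, by linear_combination hx + hy⟩
    have h₂ := hlt (g i)
    have := eq_zero_of_dvd_of_lt h₁ (by omega) (by omega)
    omega

end CycleLabelling

lemma iff_sub_mul_of_periodic {P : ℤ → Prop} {q : ℤ} (h : ∀ i, P i ↔ P (i - q)) (i k : ℤ) :
    P i ↔ P (i - q * k) := by
  induction k with
  | zero => simp
  | succ k ih => rw [ih, h, show i - q * k - q = i - q * (k + 1) by ring]
  | pred k ih => rw [ih, h (i - q * (-k - 1)), show i - q * (-k - 1) - q = i - q * -k by ring]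

lemma iff_emod_of_periodic {P : ℤ → Prop} {q : ℤ} (h : ∀ i, P i ↔ P (i - q)) (i : ℤ) :
    P i ↔ P (i % q) := by
  rw [iff_sub_mul_of_periodic h i (i / q), Int.emod_def]

lemma sum_range_mul_of_periodic {f : ℕ → ℤ} {q : ℕ} (h : ∀ i, f (i + q) = f i) (m : ℕ) :
    ∑ i ∈ Finset.range (q * m), f i = m * ∑ i ∈ Finset.range q, f i := by
  have hm : ∀ m i, f (q * m + i) = f i := by
    intro m
    induction m with
    | zero => simp
    | succ m ih => intro i; rw [← ih i, ← h (q * m + i)]; congr 1; ring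
  induction m with
  | zero => simp
  | succ m ih =>
    rw [Nat.mul_succ, Finset.sum_range_add, ih]
    simp only [hm]
    push_cast
    ring

namespace CycleLabelling

variable {V : Type*} [Fintype V] {G : SimpleGraph V} {n : ℤ} {p : ℤ → V} {d : ℤ → ℤ}

/-- If forward and backward short sides alternate, only one exceptional labelling arises. -/
lemma hasConnectedPDS_of_alternating (L : CycleLabelling G n p d) {s t : ℤ}
    (hs : s = (2 * n + 1) / 3) (ht : t = n - s) (hn3 : n % 3 ≠ 0) (hn2 : n % 2 = 0)
    (he : ∀ i, i % 2 = 0 → d i ≤ t) (ho : ∀ i, i % 2 = 1 → s ≤ d i) :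
    HasConnectedPDS G ∨ (n = 8 ∧ ∀ i, d i = if i % 2 = 0 then 3 else 5) := by
  have hn := L.four_le
  by_cases hG : HasConnectedPDS G
  · exact Or.inl hG
  have hodd : ∀ i, i % 2 = 0 → d i % 2 = 1 := by
    intro i hi
    by_contra h
    have h₁ := he (i + d i) (by omega)
    rw [L.d_add_d] at h₁
    have := he i hi
    omega
  have hforce : ∀ v x, v % 2 = 0 → x % 2 = 1 → 3 ≤ x → x ≤ s - t - 1 → d v = x := by
    intro v x hv hx h3 hxs
    by_contra hne
    refine hG (L.hasConnectedPDS_split (a := v + x - s) (u := v - 1) (w := v + 1) (b := v + x)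
      (by omega) (by omega) (by omega) (by omega) (by omega) ?_ ?_ ?_ ?_)
    · have h₁ := he (v + x - s) (by omega)
      have h₂ := hodd (v + x - s) (by omega)
      omega
    · have := ho (v - 1) (by omega)
      omega
    · have h₁ := ho (v + 1) (by omega)
      have h₂ := L.le_sub_two (v + 1)
      have h₃ : d (v + 1) ≠ n - (v + 1 - v) := by omega
      omega
    · have h₁ := ho (v + x) (by omega)
      have h₂ : d (v + x) ≠ n - (v + x - v) := fun h => hne (by
        have := L.d_of_backward h
        omega)
      omega
  have hd : (∀ i, i % 2 = 0 → d i = 3) → ∀ i, d i = if i % 2 = 0 then 3 else n - 3 := by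
    intro h i
    split_ifs with hi
    · exact h i hi
    · have h₁ := L.d_of_forward (i := i - 3) (j := i) (by rw [h _ (by omega)]; ring)
      omega
  rcases (show n = 4 ∨ n = 8 ∨ n = 10 ∨ n = 14 ∨ 5 ≤ s - t - 1 by omega) with
    rfl | rfl | rfl | rfl | hbig
  · have h₁ := L.two_le 0
    have h₂ := he 0 rfl
    omega
  · refine Or.inr ⟨rfl, hd fun i hi => ?_⟩
    have h₁ := L.two_le i
    have h₂ := he i hi
    have h₃ := hodd i hi
    omega
  · have h := hd fun i hi => hforce i 3 hi rfl (by omega) (by omega)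
    refine Or.inl (L.hasConnectedPDS {0, 1, 2, 3, 4, 7, 8} 0 ?_ ?_ ?_ ?_ ?_) <;>
      simp [h]
  · have h := hd fun i hi => hforce i 3 hi rfl (by omega) (by omega)
    refine Or.inl (L.hasConnectedPDS {0, 1, 2, 3, 5, 6, 7, 8, 9} 0 ?_ ?_ ?_ ?_ ?_) <;>
      simp [h]
  · have h₁ := hforce 0 3 rfl rfl (by omega) (by omega)
    have h₂ := hforce 0 5 rfl rfl (by omega) (by omega)
    omega

end CycleLabelling

namespace CycleLabelling

variable {V : Type*} [Fintype V] {G : SimpleGraph V} {n : ℤ} {p : ℤ → V} {d : ℤ → ℤ}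

/-- If forward and backward short sides alternate in pairs, only one exceptional labelling
arises. -/
lemma hasConnectedPDS_of_alternating_pairs (L : CycleLabelling G n p d) {k : ℤ}
    (hn : n = 12 * k + 8) (hfwd : ∀ i, i % 4 < 2 → d i ≤ 4 * k + 3)
    (hbwd : ∀ i, 2 ≤ i % 4 → 8 * k + 5 ≤ d i) :
    HasConnectedPDS G ∨ (n = 8 ∧ ∀ i, d i = if i % 4 < 2 then 2 else 6) := by
  have hn₄ := L.four_le
  have htarget : ∀ i, i % 4 < 2 → 2 ≤ (i + d i) % 4 := by
    intro i hi
    by_contra h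
    have h₁ := hfwd (i + d i) (by omega)
    have h₂ := hfwd i hi
    rw [L.d_add_d] at h₁
    omega
  rcases (show k = 0 ∨ 1 ≤ k by omega) with rfl | hk
  · obtain rfl : n = 8 := by omega
    refine Or.inr ⟨rfl, ?_⟩
    have h₁ : ∀ i, i % 4 = 1 → d i = 2 := by
      intro i hi
      have h₁ := L.two_le i
      have h₂ := hfwd i (by omega)
      have h₃ := htarget i (by omega)
      omega
    have h₀ : ∀ i, i % 4 = 0 → d i = 2 := by
      intro i hi
      have h₂ := L.two_le i
      have h₃ := hfwd i (by omega)
      by_contra hne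
      have h₄ := L.d_of_forward (i := i) (j := i + 3) (by omega)
      have h₅ := L.d_of_forward (i := i + 1) (j := i + 3) (by rw [h₁ _ (by omega)]; ring)
      omega
    intro i
    split_ifs with hi
    · rcases (show i % 4 = 0 ∨ i % 4 = 1 by omega) with h | h
      exacts [h₀ i h, h₁ i h]
    · have h : d (i - 2) = 2 := by
        rcases (show i % 4 = 2 ∨ i % 4 = 3 by omega) with h | h
        exacts [h₀ _ (by omega), h₁ _ (by omega)]
      have := L.d_of_forward (i := i - 2) (j := i) (by omega)
      omega
  by_cases hG : HasConnectedPDS G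
  · exact Or.inl hG
  exfalso
  have htriangle : ∀ v, v % 4 = 1 → d (v - 1) ≠ 2 := by
    intro v hv h
    have h' := L.d_of_forward (i := v - 1) (j := v + 1) (by omega)
    refine hG (L.hasConnectedPDS_split (a := v - 4) (u := v - 1) (w := v + 1) (b := v + 8 * k + 1)
      (by omega) (by omega) (by omega) (by omega) (by omega) ?_ ?_ ?_ ?_)
    · have h₁ := hfwd (v - 4) (by omega)
      have h₂ := htarget (v - 4) (by omega)
      omega
    · omega
    · omega
    · have := hbwd (v + 8 * k + 1) (by omega)
      omega
  have hshort : ∀ v x, v % 4 = 0 → x % 4 = 2 → 6 ≤ x → x ≤ 4 * k + 2 →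
      d v = x ∨ d (v + 1) = x - 1 := by
    intro v x hv hx h6 hxk
    by_contra! hne
    refine hG (L.hasConnectedPDS_split (a := v + x - (8 * k + 6)) (u := v - 1) (w := v + 2)
      (b := v + x) (by omega) (by omega) (by omega) (by omega) (by omega) ?_ ?_ ?_ ?_)
    · have h₁ := hfwd (v + x - (8 * k + 6)) (by omega)
      have h₂ := htarget (v + x - (8 * k + 6)) (by omega)
      omega
    · have := hbwd (v - 1) (by omega)
      omega
    · have h₁ := hbwd (v + 2) (by omega)
      have h₂ := L.le_sub_two (v + 2)
      have h₃ : d (v + 2) ≠ n - (v + 2 - v) := fun h₃ => by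
        have h₄ := L.d_of_backward h₃
        refine htriangle (v + 1) (by omega) ?_
        rw [add_sub_cancel_right]
        omega
      omega
    · have h₁ := hbwd (v + x) (by omega)
      have h₂ : d (v + x) ≠ n - (v + x - v) := fun h => by
        have := L.d_of_backward h
        omega
      have h₃ : d (v + x) ≠ n - (v + x - (v + 1)) := fun h => by
        have := L.d_of_backward h
        omega
      omega
  have hlong : ∀ v, v % 4 = 0 →
      d (v - 4 * k - 4) = 4 * k + 3 ∨ d v = 4 * k + 3 ∨ d (v + 1) = 4 * k + 2 := by
    intro v hv
    by_contra! hne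
    refine hG (L.hasConnectedPDS_split (a := v - 4 * k - 3) (u := v - 1) (w := v + 2)
      (b := v + 4 * k + 3) (by omega) (by omega) (by omega) (by omega) (by omega) ?_ ?_ ?_ ?_)
    · have h₁ := hfwd (v - 4 * k - 3) (by omega)
      have h₂ := htarget (v - 4 * k - 3) (by omega)
      omega
    · have h₁ := hbwd (v - 1) (by omega)
      have h₂ : d (v - 1) ≠ n - (v - 1 - (v - 4 * k - 4)) := fun h => by
        have := L.d_of_backward h
        omega
      omega
    · have h₁ := hbwd (v + 2) (by omega)
      have h₂ := L.le_sub_two (v + 2)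
      have h₃ : d (v + 2) ≠ n - (v + 2 - v) := fun h₃ => by
        have h₄ := L.d_of_backward h₃
        refine htriangle (v + 1) (by omega) ?_
        rw [add_sub_cancel_right]
        omega
      omega
    · have h₁ := hbwd (v + 4 * k + 3) (by omega)
      have h₂ : d (v + 4 * k + 3) ≠ n - (v + 4 * k + 3 - v) := fun h => by
        have := L.d_of_backward h
        omega
      have h₃ : d (v + 4 * k + 3) ≠ n - (v + 4 * k + 3 - (v + 1)) := fun h => by
        have := L.d_of_backward h
        omega
      omega
  rcases (show k = 1 ∨ 2 ≤ k by omega) with rfl | hk₂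
  · have hsquare : ∀ v, v % 4 = 0 →
        ¬ ((d v = 6 ∧ d (v + 1) = 6) ∨ (d v = 7 ∧ d (v + 1) = 5)) := by
      intro v hv h
      have hends : (d (v + 6) = n - 6 ∧ d (v + 7) = n - 6) ∨
          (d (v + 7) = n - 7 ∧ d (v + 6) = n - 5) := by
        rcases h with ⟨h₁, h₂⟩ | ⟨h₁, h₂⟩
        · have h₃ := L.d_of_forward (i := v) (j := v + 6) (by omega)
          have h₄ := L.d_of_forward (i := v + 1) (j := v + 7) (by omega)
          omega
        · have h₃ := L.d_of_forward (i := v) (j := v + 7) (by omega)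
          have h₄ := L.d_of_forward (i := v + 1) (j := v + 6) (by omega)
          omega
      refine hG (L.hasConnectedPDS_split (a := v - 8) (u := v + 2) (w := v + 6) (b := v + 7)
        (by omega) (by omega) (by omega) (by omega) (by omega) ?_ ?_ ?_ ?_)
      · have := hfwd (v - 8) (by omega)
        omega
      · have := hbwd (v + 2) (by omega)
        omega
      · omega
      · omega
    have h : ∀ v, v % 4 = 0 → d v = 7 → d (v + 1) = 5 := by
      intro v hv h
      have := hshort v 6 hv rfl le_rfl (by omega)
      omega
    have h₀ := hshort 0 6 rfl rfl le_rfl (by omega)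
    have h₁ := hlong 0 rfl
    have h₂ := hsquare 0 rfl
    have h₃ := hsquare (0 - 4 * 1 - 4) rfl
    have h₄ := h (0 - 4 * 1 - 4) rfl
    omega
  · have h : ∀ v, v % 4 = 0 → d v ≠ 4 * k + 3 ∧ d (v + 1) ≠ 4 * k + 2 := by
      intro v hv
      have h₁ := hshort v (4 * k + 2) hv (by omega) (by omega) (by omega)
      have h₂ := hshort v (4 * k - 2) hv (by omega) (by omega) (by omega)
      omega
    have h₁ := hlong 0 rfl
    have h₂ := h 0 rfl
    have h₃ := h (0 - 4 * k - 4) (by omega)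
    omega

/-- A graph whose labelling agrees with the adjacency of `H` on eight vertices is isomorphic
to `H`. -/
lemma nonempty_iso (L : CycleLabelling G 8 p d) (H : SimpleGraph (ZMod 8))
    (hH : ∀ z w : ZMod 8, H.Adj z w ↔ (8 : ℤ) ∣ w.val - (z.val - 1) ∨
      (8 : ℤ) ∣ w.val - (z.val + 1) ∨ (8 : ℤ) ∣ w.val - (z.val + d z.val)) : Nonempty (G ≃g H) := by
  have hinj : Function.Injective fun z : ZMod 8 => p z.val := by
    intro z w h
    have hz := ZMod.val_lt z
    have hw := ZMod.val_lt w
    have := eq_zero_of_dvd_of_lt ((L.eq_iff _ _).mp h) (by omega) (by omega)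
    exact ZMod.val_injective 8 (by omega)
  have hbij : Function.Bijective fun z : ZMod 8 => p z.val := by
    rw [Fintype.bijective_iff_injective_and_card]
    refine ⟨hinj, ?_⟩
    have := L.card_eq
    rw [ZMod.card]
    omega
  refine ⟨RelIso.symm ⟨Equiv.ofBijective _ hbij, ?_⟩⟩
  intro z w
  rw [Equiv.ofBijective_apply, Equiv.ofBijective_apply, L.adj_iff, hH]
  simp only [L.eq_iff]

end CycleLabelling

/-- A graph without connected proportionally dense subgraph of the right size has eight vertices,
and its labelling is, up to rotation, one of two exceptional ones. -/
lemma hasConnectedPDS_or_exceptional {V : Type*} [Fintype V] {G : SimpleGraph V} {n : ℤ}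
    {p : ℤ → V} {d : ℤ → ℤ} (L : CycleLabelling G n p d) :
    HasConnectedPDS G ∨ ∃ r, n = 8 ∧
      ((∀ i, d (i + r) = if i % 2 = 0 then 3 else 5) ∨
        ∀ i, d (i + r) = if i % 4 < 2 then 2 else 6) := by
  by_cases hG : HasConnectedPDS G
  · exact Or.inl hG
  have hn := L.four_le
  obtain ⟨s, hs⟩ : ∃ s, s = (2 * n + 1) / 3 := ⟨_, rfl⟩
  obtain ⟨t, ht⟩ : ∃ t, t = n - s := ⟨_, rfl⟩
  obtain ⟨hd, hper⟩ := L.short_of_not_hasConnectedPDS hG hs ht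
  have hsum := L.sum_sign_eq_zero (by omega) ht hd
  have hper₃ : ∀ i, d i ≤ t ↔ d (i - (3 * (t + 1) - n)) ≤ t := by
    intro i
    rw [hper i, hper, hper, ← L.d_add_mul _ 1]
    ring_nf
  have hn₂ : n % 2 = 0 := by
    have h : ∀ i : ℕ, (if d i ≤ t then (1 : ℤ) else -1) = 2 * (if d i ≤ t then 1 else 0) - 1 := by
      intro i
      split_ifs <;> rfl
    simp only [h, Finset.sum_sub_distrib, ← Finset.mul_sum, Finset.sum_const, Finset.card_range,
      nsmul_eq_mul, mul_one] at hsum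
    omega
  have alternating : (∀ i, d i ≤ t ↔ d (i - 2) ≤ t) → n % 3 ≠ 0 →
      HasConnectedPDS G ∨ ∃ r, n = 8 ∧
        ((∀ i, d (i + r) = if i % 2 = 0 then 3 else 5) ∨
          ∀ i, d (i + r) = if i % 4 < 2 then 2 else 6) := by
    intro h₂ hn₃
    have hmod := iff_emod_of_periodic h₂
    rw [show n.toNat = 2 * (n.toNat / 2) by omega, sum_range_mul_of_periodic] at hsum
    · obtain ⟨r, h₀, h₁⟩ : ∃ r, d r ≤ t ∧ ¬ d (1 + r) ≤ t := by
        have h := (mul_eq_zero.mp hsum).resolve_left (by omega)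
        simp only [Finset.sum_range_succ, Finset.sum_range_zero] at h
        push_cast at h
        by_cases h₀ : d 0 ≤ t
        · refine ⟨0, h₀, fun h₁ => ?_⟩
          simp only [add_zero] at h₁
          simp [h₀, h₁] at h
        · refine ⟨1, ?_, ?_⟩
          · by_contra h₁
            simp [h₀, h₁] at h
          · rw [hmod]
            exact h₀
      have he : ∀ i, i % 2 = 0 → d (i + r) ≤ t := by
        intro i hi
        rw [iff_sub_mul_of_periodic h₂ (i + r) (i / 2)]
        rwa [show i + r - 2 * (i / 2) = r by omega]
      have ho : ∀ i, i % 2 = 1 → s ≤ d (i + r) := by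
        intro i hi
        refine (hd _).resolve_left ?_
        rw [iff_sub_mul_of_periodic h₂ (i + r) (i / 2)]
        rwa [show i + r - 2 * (i / 2) = 1 + r by omega]
      rcases (L.rotate r).hasConnectedPDS_of_alternating hs ht hn₃ hn₂ he ho with h | ⟨h₈, h⟩
      · exact Or.inl h
      · exact Or.inr ⟨r, h₈, Or.inl h⟩
    · intro i
      have h := h₂ (i + 2 : ℕ)
      rw [show ((i + 2 : ℕ) : ℤ) - 2 = i by push_cast; ring] at h
      simp only [h]
  rcases (show n % 3 = 0 ∨ n % 3 = 1 ∨ n % 4 = 2 ∧ n % 3 = 2 ∨ n % 12 = 8 by omega) with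
    h | h | ⟨h₄, h₃⟩ | h
  · rw [show 3 * (t + 1) - n = 3 by omega] at hper₃
    rw [show n.toNat = 3 * (n.toNat / 3) by omega, sum_range_mul_of_periodic] at hsum
    · have h := (mul_eq_zero.mp hsum).resolve_left (by omega)
      simp only [Finset.sum_range_succ, Finset.sum_range_zero] at h
      split_ifs at h <;> omega
    · intro i
      have h := hper₃ (i + 3 : ℕ)
      rw [show ((i + 3 : ℕ) : ℤ) - 3 = i by push_cast; ring] at h
      simp only [h]
  · rw [show 3 * (t + 1) - n = 2 by omega] at hper₃
    exact alternating hper₃ (by omega)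
  · rw [show 3 * (t + 1) - n = 4 by omega] at hper₃
    refine alternating (fun i => ?_) (by omega)
    rw [hper i, iff_sub_mul_of_periodic hper₃ (i - 2) (t / 4)]
    have : i - (t + 1) = i - 2 - 4 * (t / 4) := by omega
    rw [this]
  · rw [show 3 * (t + 1) - n = 4 by omega] at hper₃
    have hmod := iff_emod_of_periodic hper₃
    rw [show n.toNat = 4 * (n.toNat / 4) by omega, sum_range_mul_of_periodic] at hsum
    · have h4 := (mul_eq_zero.mp hsum).resolve_left (by omega)
      simp only [Finset.sum_range_succ, Finset.sum_range_zero] at h4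
      push_cast at h4
      by_cases h02 : d 0 ≤ t ↔ d 2 ≤ t
      · refine alternating (fun i => ?_) (by omega)
        have h13 : d 1 ≤ t ↔ d 3 ≤ t := by
          split_ifs at h4 <;> omega
        rw [hmod i, hmod (i - 2)]
        rcases (show i % 4 = 0 ∨ i % 4 = 1 ∨ i % 4 = 2 ∨ i % 4 = 3 by omega) with hi | hi | hi | hi
        · rwa [hi, show (i - 2) % 4 = 2 by omega]
        · rwa [hi, show (i - 2) % 4 = 3 by omega]
        · rw [hi, show (i - 2) % 4 = 0 by omega, h02]
        · rw [hi, show (i - 2) % 4 = 1 by omega, h13]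
      · obtain ⟨r, h₀, h₁, h₂, h₃⟩ :
            ∃ r, d r ≤ t ∧ d (1 + r) ≤ t ∧ ¬ d (2 + r) ≤ t ∧ ¬ d (3 + r) ≤ t := by
          have e₄ := hmod 4
          have e₅ := hmod 5
          have e₆ := hmod 6
          norm_num at e₄ e₅ e₆
          by_cases h₀ : d 0 ≤ t <;> by_cases h₁ : d 1 ≤ t
          · exact ⟨0, by norm_num; split_ifs at h4 <;> omega⟩
          · exact ⟨3, by norm_num; split_ifs at h4 <;> omega⟩
          · exact ⟨1, by norm_num; split_ifs at h4 <;> omega⟩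
          · exact ⟨2, by norm_num; split_ifs at h4 <;> omega⟩
        have hres : ∀ i j, i % 4 = j → (d (i + r) ≤ t ↔ d (j + r) ≤ t) := by
          intro i j hij
          rw [iff_sub_mul_of_periodic hper₃ (i + r) (i / 4)]
          rw [show i + r - 4 * (i / 4) = j + r by omega]
        have hfwd : ∀ i, i % 4 < 2 → d (i + r) ≤ 4 * (n / 12) + 3 := by
          intro i hi
          have : d (i + r) ≤ t := by
            rcases (show i % 4 = 0 ∨ i % 4 = 1 by omega) with hi | hi
            · rwa [hres i 0 hi, zero_add]
            · rwa [hres i 1 hi]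
          omega
        have hbwd : ∀ i, 2 ≤ i % 4 → 8 * (n / 12) + 5 ≤ d (i + r) := by
          intro i hi
          have : ¬ d (i + r) ≤ t := by
            rcases (show i % 4 = 2 ∨ i % 4 = 3 by omega) with hi | hi
            · rwa [hres i 2 hi]
            · rwa [hres i 3 hi]
          have := hd (i + r)
          omega
        rcases (L.rotate r).hasConnectedPDS_of_alternating_pairs (by omega) hfwd hbwd with
          h | ⟨h₈, h⟩
        · exact Or.inl h
        · exact Or.inr ⟨r, h₈, Or.inr h⟩
    · intro i
      have h := hper₃ (i + 4 : ℕ)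
      rw [show ((i + 4 : ℕ) : ℤ) - 4 = i by push_cast; ring] at h
      simp only [h]

/-- Theorem 5 of the paper: every Hamiltonian cubic graph not isomorphic to `H1`
or `H2` has a connected PDS of size `⌊(2n+1)/3⌋`. -/
theorem hamiltonian_cubic_pds {V : Type*} [Fintype V] [DecidableEq V] (G : SimpleGraph V)
    (hcubic : ∀ v : V, (G.neighborSet v).ncard = 3)
    (hham : G.IsHamiltonian)
    (hH1 : ¬ Nonempty (G ≃g H1)) (hH2 : ¬ Nonempty (G ≃g H2)) :
    ∃ S : Set V, IsPDS G S ∧ S.ncard = (2 * Fintype.card V + 1) / 3 ∧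
      (G.induce S).Connected := by
  obtain ⟨n, p, d, L⟩ := exists_cycleLabelling G hcubic hham
  rcases hasConnectedPDS_or_exceptional L with h | ⟨r, rfl, h | h⟩
  · exact h
  · refine absurd ((L.rotate r).nonempty_iso H2 ?_) hH2
    simp only [h, H2, SimpleGraph.fromRel_adj]
    decide
  · refine absurd ((L.rotate r).nonempty_iso H1 ?_) hH1
    simp only [h, H1, SimpleGraph.fromRel_adj]
    decide
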